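/- Let P be a submonoid of a group G, let n, m ≥ 1, and let p₁, q₁, …, p_n, q_n ∈ P and r₁, s₁, …, r_m, s_m ∈ P. Suppose the bounded operators V_{p₁}* V_{q₁} ⋯ V_{p_n}* V_{q_n} and V_{r₁}* V_{s₁} ⋯ V_{r_m}* V_{s_m} on ℓ²(P) are equal and nonzero. Then p₁⁻¹q₁ ⋯ p_n⁻¹q_n = r₁⁻¹s₁ ⋯ r_m⁻¹s_m in the group G. (In particular the map σ sending a nonzero operator word V_{p₁}* V_{q₁} ⋯ V_{p_n}* V_{q_n} to p₁⁻¹q₁ ⋯ p_n⁻¹q_n ∈ G is well defined.) -/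

import Mathlib

noncomputable section

open ContinuousLinearMap
open scoped Classical

variable {G : Type*} [Group G]

/-- The Hilbert space ℓ²(P). -/
abbrev l2 (P : Submonoid G) : Type _ := lp (fun _ : P => ℂ) 2

/-- The standard orthonormal basis vector δ_s of ℓ²(P). -/
def delta (P : Submonoid G) (s : P) : l2 P :=
  letI := Classical.decEq P
  lp.single 2 s 1

/-- The set pX = {px : x ∈ X}. -/
def lmul (P : Submonoid G) (p : P) (X : Set P) : Set P := (fun x => p * x) '' X

/-- The set p⁻¹X = {y ∈ P : py ∈ X}. -/
def linv (P : Submonoid G) (p : P) (X : Set P) : Set P := {y : P | p * y ∈ X}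

/-- The set p₁⁻¹q₁ ⋯ pₙ⁻¹qₙ X, the operations being applied iteratively from the right;
the word is encoded as the list [(p₁,q₁),…,(pₙ,qₙ)]. -/
def wordSet (P : Submonoid G) (l : List (P × P)) (X : Set P) : Set P :=
  l.foldr (fun a Y => linv P a.1 (lmul P a.2 Y)) X

/-- The operator V_{p₁}* V_{q₁} ⋯ V_{pₙ}* V_{qₙ} on ℓ²(P), the word being encoded as the
list [(p₁,q₁),…,(pₙ,qₙ)]. -/
def opWord (P : Submonoid G) (V : P → (l2 P →L[ℂ] l2 P)) (l : List (P × P)) :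
    l2 P →L[ℂ] l2 P :=
  (l.map fun a => (ContinuousLinearMap.adjoint (V a.1)) * (V a.2)).prod

/-- The group element p₁⁻¹q₁ ⋯ pₙ⁻¹qₙ of G. -/
def grpWord (P : Submonoid G) (l : List (P × P)) : G :=
  (l.map fun a => ((a.1 : G))⁻¹ * (a.2 : G)).prod

/-- The inner product with a basis vector reads off a coordinate. -/
theorem inner_delta_left (P : Submonoid G) (t : P) (f : l2 P) :
    inner ℂ (delta P t) f = f t := by
  simp [delta, lp.inner_single_left]

theorem delta_apply (P : Submonoid G) (s t : P) :
    delta P s t = if t = s then 1 else 0 := by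
  simp [delta, Pi.single_apply]

theorem delta_injective (P : Submonoid G) : Function.Injective (delta P) := by
  intro s t h
  by_contra hst
  have h' := delta_apply P s s
  simp [h, delta_apply, hst] at h'

/-- A bounded operator on ℓ²(P) that kills every basis vector is zero. -/
theorem eq_zero_of_forall_delta (P : Submonoid G) (T : l2 P →L[ℂ] l2 P)
    (h : ∀ s, T (delta P s) = 0) : T = 0 := by
  have hadj : ∀ f, ContinuousLinearMap.adjoint T f = 0 := by
    intro f
    ext t
    rw [← inner_delta_left, ContinuousLinearMap.adjoint_inner_right, h]
    simp
  rw [← ContinuousLinearMap.adjoint_adjoint T,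
    show ContinuousLinearMap.adjoint T = 0 from ContinuousLinearMap.ext hadj, map_zero]

/-- The adjoint of left translation by `a` sends `δ_u` to `δ_t` if `u = at`, and to zero
if `u` is not of this form. -/
theorem adjoint_delta (P : Submonoid G) (V : P → (l2 P →L[ℂ] l2 P))
    (hV : ∀ p s : P, V p (delta P s) = delta P (p * s)) (a u : P) :
    ContinuousLinearMap.adjoint (V a) (delta P u) = 0 ∨
      ∃ t, ContinuousLinearMap.adjoint (V a) (delta P u) = delta P t ∧ a * t = u := by
  have coord : ∀ t, ContinuousLinearMap.adjoint (V a) (delta P u) t =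
      if a * t = u then 1 else 0 := by
    intro t
    rw [← inner_delta_left, ContinuousLinearMap.adjoint_inner_right, hV, inner_delta_left,
      delta_apply]
  by_cases h : ∃ t, a * t = u
  · obtain ⟨t, rfl⟩ := h
    refine Or.inr ⟨t, ?_, rfl⟩
    ext x
    rw [coord, delta_apply]
    simp
  · refine Or.inl ?_
    ext x
    rw [coord, if_neg fun hx => h ⟨x, hx⟩]
    simp

/-- An operator word sends each basis vector to zero or translates it by its group element. -/
theorem opWord_delta (P : Submonoid G) (V : P → (l2 P →L[ℂ] l2 P))
    (hV : ∀ p s : P, V p (delta P s) = delta P (p * s)) (l : List (P × P)) (s : P) :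
    opWord P V l (delta P s) = 0 ∨
      ∃ t : P, opWord P V l (delta P s) = delta P t ∧ (t : G) = grpWord P l * s := by
  induction l with
  | nil => exact Or.inr ⟨s, by simp [opWord], by simp [grpWord]⟩
  | cons a l ih =>
    have hop : opWord P V (a :: l) (delta P s) =
        ContinuousLinearMap.adjoint (V a.1) (V a.2 (opWord P V l (delta P s))) := by
      simp [opWord]
    have hgrp : grpWord P (a :: l) = (a.1 : G)⁻¹ * a.2 * grpWord P l := by
      simp [grpWord]
    rw [hop, hgrp]
    obtain h | ⟨t, h, ht⟩ := ih
    · left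
      simp [h]
    · rw [h, hV]
      refine (adjoint_delta P V hV a.1 (a.2 * t)).imp_right ?_
      rintro ⟨u, hu, hau⟩
      refine ⟨u, hu, ?_⟩
      have hG : (a.1 : G) * u = a.2 * t := by exact_mod_cast hau
      rw [mul_assoc, mul_assoc, ← ht, ← hG, inv_mul_cancel_left]

/-- If two nonzero operator words agree, then the corresponding group elements agree. -/
theorem stmt9 (P : Submonoid G)
    (V : P → (l2 P →L[ℂ] l2 P))
    (hV : ∀ p s : P, V p (delta P s) = delta P (p * s))
    (n m : ℕ) (hn : 1 ≤ n) (hm : 1 ≤ m)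
    (p q : Fin n → P) (r s : Fin m → P)
    (heq : opWord P V (List.ofFn fun i => (p i, q i))
            = opWord P V (List.ofFn fun i => (r i, s i)))
    (hne : opWord P V (List.ofFn fun i => (p i, q i)) ≠ 0) :
    grpWord P (List.ofFn fun i => (p i, q i))
      = grpWord P (List.ofFn fun i => (r i, s i)) := by
  obtain ⟨x, hx⟩ : ∃ x, opWord P V (List.ofFn fun i => (p i, q i)) (delta P x) ≠ 0 := by
    by_contra! h
    exact hne (eq_zero_of_forall_delta P _ h)
  obtain h | ⟨t, ht, htG⟩ := opWord_delta P V hV (List.ofFn fun i => (p i, q i)) x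
  · exact absurd h hx
  obtain h | ⟨u, hu, huG⟩ := opWord_delta P V hV (List.ofFn fun i => (r i, s i)) x
  · exact absurd (heq ▸ h) hx
  have htu : t = u := delta_injective P (by rw [← ht, heq, hu])
  rw [htu, huG] at htG
  exact (mul_right_cancel htG).symm
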